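/- arXiv:1808.02253 — 2 statements merged into one kernel-verified Lean document; each statement's English description precedes it below -/
import Mathlib

section
/- Let n be a nonempty finite type, 0 < α < 1, and A an n×n real matrix with complexification A_ℂ. Then every eigenvalue λ ∈ spectrum ℂ A_ℂ satisfies arg(λ) ≠ arg(ζ) for every ζ ∈ ℂ with E_α(ζ) = 0, if and only if for every nonzero x₀ ∈ ℝ^n and every t > 0 one has E_α(t^α • A) · x₀ ≠ 0. -/
/-- The Mittag-Leffler function `E_α(z) = ∑ z^k / Γ(αk+1)`. -/
noncomputable def mlE (α : ℝ) (z : ℂ) : ℂ :=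
  ∑' k : ℕ, ((Real.Gamma (α * k + 1) : ℂ))⁻¹ * z ^ k

/-- The Mittag-Leffler matrix function `E_α(A) = ∑ A^k / Γ(αk+1)` of a real matrix. -/
noncomputable def mlMatR (α : ℝ) {n : Type*} [Fintype n] [DecidableEq n]
    (A : Matrix n n ℝ) : Matrix n n ℝ :=
  ∑' k : ℕ, (Real.Gamma (α * k + 1))⁻¹ • A ^ k

theorem mlaux_gamma_lower (R x : ℝ) (hR : 0 < R) (hx : 0 ≤ x) :
    R ^ x * Real.exp (-R) ≤ Real.Gamma (x + 1) := by
  rw [Real.Gamma_eq_integral (by linarith)]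
  have hint := Real.GammaIntegral_convergent (s := x + 1) (by linarith)
  have h1 : R ^ x * Real.exp (-R) = ∫ t in Set.Ioi R, R ^ x * Real.exp (-t) := by
    rw [MeasureTheory.integral_const_mul, integral_exp_neg_Ioi]
  have hsub : Set.Ioi R ⊆ Set.Ioi 0 := Set.Ioi_subset_Ioi hR.le
  rw [h1]
  calc _ ≤ ∫ t in Set.Ioi R, Real.exp (-t) * t ^ (x + 1 - 1) := by
        apply MeasureTheory.setIntegral_mono_on
        · exact (integrableOn_exp_neg_Ioi R).const_mul _
        · exact hint.mono_set hsub
        · exact measurableSet_Ioi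
        · intro t ht
          have ht' : R < t := ht
          rw [mul_comm, add_sub_cancel_right]
          gcongr
    _ ≤ _ := by
        apply MeasureTheory.setIntegral_mono_set hint
        · filter_upwards [MeasureTheory.ae_restrict_mem measurableSet_Ioi] with t ht
          have : (0:ℝ) < t := ht
          simp only [Pi.zero_apply]
          positivity
        · exact hsub.eventuallyLE

theorem mlaux_summable (α : ℝ) (hα0 : 0 < α) (r : ℝ) (hr : 0 ≤ r) :
    Summable fun k : ℕ => (Real.Gamma (α * k + 1))⁻¹ * r ^ k := by
  set R : ℝ := (2 * r + 1) ^ (α⁻¹) with hRdef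
  have hR : 0 < R := by positivity
  have hRα : R ^ α = 2 * r + 1 := by
    rw [hRdef, ← Real.rpow_mul (by positivity), inv_mul_cancel₀ hα0.ne', Real.rpow_one]
  have hq : r / (2 * r + 1) < 1 := by
    rw [div_lt_one (by positivity)]; linarith
  refine Summable.of_nonneg_of_le (fun k => ?_) (fun k => ?_)
    ((summable_geometric_of_lt_one (by positivity) hq).mul_left (Real.exp R))
  · have : 0 < Real.Gamma (α * k + 1) := Real.Gamma_pos_of_pos (by positivity)
    positivity
  · have h := mlaux_gamma_lower R (α * k) hR (by positivity)
    rw [Real.rpow_mul hR.le, hRα, Real.rpow_natCast] at h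
    have h2 : (Real.Gamma (α * k + 1))⁻¹ ≤ ((2 * r + 1) ^ k * Real.exp (-R))⁻¹ :=
      inv_anti₀ (by positivity) h
    calc _ ≤ ((2 * r + 1) ^ k * Real.exp (-R))⁻¹ * r ^ k := by gcongr
      _ = _ := by rw [Real.exp_neg, div_pow]; field_simp

theorem mlaux_hasSum (α : ℝ) (hα0 : 0 < α) (z : ℂ) :
    HasSum (fun k : ℕ => ((Real.Gamma (α * k + 1) : ℂ))⁻¹ * z ^ k) (mlE α z) := by
  apply Summable.hasSum
  apply Summable.of_norm
  refine (mlaux_summable α hα0 ‖z‖ (norm_nonneg _)).congr fun k => ?_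
  have : 0 < Real.Gamma (α * k + 1) := Real.Gamma_pos_of_pos (by positivity)
  rw [norm_mul, norm_inv, norm_pow, Complex.norm_real, Real.norm_of_nonneg this.le]

section
attribute [local instance] Matrix.linftyOpNormedRing Matrix.linftyOpNormedAlgebra

theorem mlaux_matSummable (α : ℝ) (hα0 : 0 < α) {n : Type*} [Fintype n] [DecidableEq n]
    [Nonempty n] (A : Matrix n n ℝ) :
    Summable fun k : ℕ => (Real.Gamma (α * k + 1))⁻¹ • A ^ k := by
  apply Summable.of_norm_bounded (mlaux_summable α hα0 ‖A‖ (norm_nonneg _))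
  intro k
  have : 0 < Real.Gamma (α * k + 1) := Real.Gamma_pos_of_pos (by positivity)
  rw [norm_smul, norm_inv, Real.norm_of_nonneg this.le]
  gcongr
  have : NormOneClass (Matrix n n ℝ) := Matrix.linfty_opNormOneClass
  exact norm_pow_le A k

end

theorem mlaux_matHasSum (α : ℝ) (hα0 : 0 < α) {n : Type*} [Fintype n] [DecidableEq n]
    [Nonempty n] (A : Matrix n n ℝ) :
    HasSum (fun k : ℕ => (Real.Gamma (α * k + 1))⁻¹ • A ^ k) (mlMatR α A) :=
  (mlaux_matSummable α hα0 A).hasSum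

theorem mlaux_commute (α : ℝ) (hα0 : 0 < α) {n : Type*} [Fintype n] [DecidableEq n]
    [Nonempty n] (A : Matrix n n ℝ) : A * mlMatR α A = mlMatR α A * A := by
  have h := mlaux_matHasSum α hα0 A
  refine (h.mul_left A).unique ?_
  convert h.mul_right A using 2 with k
  rw [Matrix.mul_smul, Matrix.smul_mul, ← pow_succ, ← pow_succ']

theorem mlaux_eig (α : ℝ) (hα0 : 0 < α) {n : Type*} [Fintype n] [DecidableEq n]
    [Nonempty n] (A : Matrix n n ℝ) (v : n → ℂ) (μ : ℂ)
    (hv : (A.map Complex.ofReal).mulVec v = μ • v) :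
    ((mlMatR α A).map Complex.ofReal).mulVec v = mlE α μ • v := by
  have hpow : ∀ k : ℕ, ((A.map Complex.ofReal) ^ k).mulVec v = μ ^ k • v := by
    intro k
    induction k with
    | zero => simp
    | succ k ih => rw [pow_succ, ← Matrix.mulVec_mulVec, hv, Matrix.mulVec_smul, ih, smul_smul,
        pow_succ, mul_comm]
  let φ : Matrix n n ℝ →+ (n → ℂ) :=
    { toFun := fun M => (M.map Complex.ofReal).mulVec v
      map_zero' := by simp
      map_add' := fun M N => by
        rw [Matrix.map_add _ Complex.ofReal_add, Matrix.add_mulVec] }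
  have hφ : Continuous φ := by
    change Continuous fun M : Matrix n n ℝ => (M.map Complex.ofReal).mulVec v
    exact (continuous_id.matrix_map Complex.continuous_ofReal).matrix_mulVec continuous_const
  have h1 := (mlaux_matHasSum α hα0 A).map φ hφ
  have h2 := (mlaux_hasSum α hα0 μ).smul_const v
  refine h1.unique ?_
  convert h2 using 2 with k
  change (((Real.Gamma (α * k + 1))⁻¹ • A ^ k).map Complex.ofReal).mulVec v = _
  have hm : ((Real.Gamma (α * k + 1))⁻¹ • A ^ k).map Complex.ofReal
      = ((Real.Gamma (α * k + 1) : ℂ))⁻¹ • (A.map Complex.ofReal) ^ k := by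
    have : (A ^ k).map Complex.ofReal = (A.map Complex.ofReal) ^ k :=
      map_pow Complex.ofRealHom.mapMatrix A k
    rw [← this]
    ext i j; simp
  rw [hm, Matrix.smul_mulVec, hpow, smul_smul]

theorem mlaux_arg (lam ζ : ℂ) (hl : lam ≠ 0) (hz : ζ ≠ 0) (h : lam.arg = ζ.arg) (α : ℝ)
    (hα0 : 0 < α) : ∃ t : ℝ, 0 < t ∧ ζ = ((t ^ α : ℝ) : ℂ) * lam := by
  have hl' : 0 < ‖lam‖ := norm_pos_iff.mpr hl
  have hz' : 0 < ‖ζ‖ := norm_pos_iff.mpr hz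
  refine ⟨(‖ζ‖ / ‖lam‖) ^ α⁻¹, by positivity, ?_⟩
  rw [← Real.rpow_mul (by positivity), inv_mul_cancel₀ hα0.ne', Real.rpow_one]
  have := (Complex.arg_eq_arg_iff hl hz).mp h
  push_cast; exact this.symm

theorem mlaux_pos (α : ℝ) (hα0 : 0 < α) (r : ℝ) (hr : 0 ≤ r) : mlE α (r : ℂ) ≠ 0 := by
  intro h0
  have h1 := mlaux_hasSum α hα0 (r : ℂ)
  have hs := (mlaux_summable α hα0 r hr).hasSum
  have h2 := (Complex.hasSum_ofReal.mpr hs).unique (by simpa using h1)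
  rw [h0, Complex.ofReal_eq_zero] at h2
  have hn : ∀ k : ℕ, 0 ≤ (Real.Gamma (α * k + 1))⁻¹ * r ^ k := fun k => by
    have : 0 < Real.Gamma (α * k + 1) := Real.Gamma_pos_of_pos (by positivity)
    positivity
  have h3 := hs.summable.le_tsum 0 (fun k _ => hn k)
  rw [h2] at h3
  simp at h3
  linarith

theorem no_zero_crossing_iff_arg {n : Type*} [Fintype n] [DecidableEq n] [Nonempty n]
    (α : ℝ) (hα0 : 0 < α) (hα1 : α < 1) (A : Matrix n n ℝ) :
    (∀ lam ∈ spectrum ℂ (A.map Complex.ofReal), ∀ ζ : ℂ, mlE α ζ = 0 → lam.arg ≠ ζ.arg) ↔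
      ∀ x₀ : n → ℝ, x₀ ≠ 0 → ∀ t : ℝ, 0 < t →
        (mlMatR α ((t ^ α) • A)).mulVec x₀ ≠ 0 := by
  have hspec : ∀ lam : ℂ, lam ∈ spectrum ℂ (A.map Complex.ofReal) ↔
      ∃ v : n → ℂ, v ≠ 0 ∧ (A.map Complex.ofReal).mulVec v = lam • v := by
    intro lam
    rw [← Matrix.spectrum_toLin', ← Module.End.hasEigenvalue_iff_mem_spectrum]
    constructor
    · intro h
      obtain ⟨v, hv⟩ := h.exists_hasEigenvector
      exact ⟨v, hv.2, by simpa using hv.apply_eq_smul⟩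
    · rintro ⟨v, hv0, hv⟩
      exact Module.End.hasEigenvalue_of_hasEigenvector (x := v)
        ⟨Module.End.mem_eigenspace_iff.mpr (by simpa using hv), hv0⟩
  have hdet : ∀ M : Matrix n n ℝ, (M.map Complex.ofReal).det = (M.det : ℂ) := fun M =>
    (RingHom.map_det Complex.ofRealHom M).symm
  have hsm : ∀ s : ℝ, (s • A).map Complex.ofReal = (s : ℂ) • A.map Complex.ofReal := by
    intro s; ext i j; simp
  constructor
  · intro H x₀ hx₀ t ht hM
    set s : ℝ := t ^ α with hs
    have hs0 : 0 < s := by positivity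
    set M := mlMatR α (s • A) with hMdef
    have hd : M.det = 0 := Matrix.exists_mulVec_eq_zero_iff.mp ⟨x₀, hx₀, hM⟩
    have hdC : (M.map Complex.ofReal).det = 0 := by rw [hdet, hd]; simp
    obtain ⟨w, hw0, hw⟩ := Matrix.exists_mulVec_eq_zero_iff.mpr hdC
    have hcomm : (A.map Complex.ofReal) * (M.map Complex.ofReal)
        = (M.map Complex.ofReal) * (A.map Complex.ofReal) := by
      have h := mlaux_commute α hα0 (s • A)
      rw [← hMdef, Matrix.smul_mul, Matrix.mul_smul] at h
      have h' := smul_right_injective _ hs0.ne' h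
      have := congrArg (fun N => Complex.ofRealHom.mapMatrix N) h'
      simp only [map_mul] at this
      exact this
    let f := Matrix.toLin' (A.map Complex.ofReal)
    let g := Matrix.toLin' (M.map Complex.ofReal)
    have hinv : ∀ x ∈ LinearMap.ker g, f x ∈ LinearMap.ker g := by
      intro x hx
      simp only [f, g, LinearMap.mem_ker, Matrix.toLin'_apply] at hx ⊢
      rw [Matrix.mulVec_mulVec, ← hcomm, ← Matrix.mulVec_mulVec, hx, Matrix.mulVec_zero]
    have : Nontrivial (LinearMap.ker g) := by
      refine ⟨⟨⟨w, by simpa [g] using hw⟩, 0, fun h => hw0 ?_⟩⟩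
      simpa using congrArg Subtype.val h
    obtain ⟨lam, hlam⟩ := Module.End.exists_eigenvalue (f.restrict hinv)
    obtain ⟨v, hv⟩ := hlam.exists_hasEigenvector
    have hv1 : (A.map Complex.ofReal).mulVec (v : n → ℂ) = lam • (v : n → ℂ) := by
      have := congrArg Subtype.val hv.apply_eq_smul
      simpa [f] using this
    have hv0 : (v : n → ℂ) ≠ 0 := fun h => hv.2 (Subtype.ext h)
    have hvk : (M.map Complex.ofReal).mulVec (v : n → ℂ) = 0 := by
      have := LinearMap.mem_ker.mp v.2
      rwa [Matrix.toLin'_apply] at this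
    have he := mlaux_eig α hα0 (s • A) v ((s : ℂ) * lam) (by
      rw [hsm, Matrix.smul_mulVec, hv1, smul_smul])
    rw [← hMdef, hvk] at he
    have hz : mlE α ((s : ℂ) * lam) = 0 := (smul_eq_zero.mp he.symm).resolve_right hv0
    exact H lam ((hspec lam).mpr ⟨v, hv0, hv1⟩) _ hz (Complex.arg_real_mul lam hs0).symm
  · intro H lam hlam ζ hζ harg
    have hζ0 : ζ ≠ 0 := by
      rintro rfl
      exact mlaux_pos α hα0 0 le_rfl (by simpa using hζ)
    have hl0 : lam ≠ 0 := by
      rintro rfl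
      rw [Complex.arg_zero] at harg
      obtain ⟨h1, h2⟩ := Complex.arg_eq_zero_iff.mp harg.symm
      refine mlaux_pos α hα0 ζ.re h1 ?_
      have : (ζ.re : ℂ) = ζ := Complex.ext (by simp) (by simp [h2])
      rw [this, hζ]
    obtain ⟨t, ht, hteq⟩ := mlaux_arg lam ζ hl0 hζ0 harg α hα0
    obtain ⟨v, hv0, hv⟩ := (hspec lam).mp hlam
    have he := mlaux_eig α hα0 ((t ^ α) • A) v ζ (by
      rw [hsm, Matrix.smul_mulVec, hv, smul_smul, hteq])
    rw [hζ, zero_smul] at he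
    have hd := Matrix.exists_mulVec_eq_zero_iff.mp ⟨v, hv0, he⟩
    rw [hdet, Complex.ofReal_eq_zero] at hd
    obtain ⟨x, hx0, hx⟩ := Matrix.exists_mulVec_eq_zero_iff.mpr hd
    exact H x hx0 t ht hx
end

section
/- (Generalized separation theorem for linear fractional systems.) Let n be a nonempty finite type, 0 < α < 1, and A an n×n real matrix with complexification A_ℂ. Assume every eigenvalue λ ∈ spectrum ℂ A_ℂ satisfies arg(λ) ≠ arg(ζ) for every ζ ∈ ℂ with E_α(ζ) = 0. Then for every p ∈ ℝ^n and every T > 0 there exists a unique x_T ∈ ℝ^n such that E_α(T^α • A) · x_T = p; i.e., precisely one trajectory of the system passes through p at time T. -/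
open Filter Topology in
theorem ml_summable (α : ℝ) (hα0 : 0 < α) (r : ℝ) (hr : 0 ≤ r) :
    Summable (fun k : ℕ => (Real.Gamma (α * k + 1))⁻¹ * r ^ k) := by
  set R : ℝ := 2 * (r + 1) with hR
  have hR1 : 1 ≤ R := by rw [hR]; linarith
  set S : ℝ := R ^ (1 / α) with hS
  have hSpos : 0 < S := Real.rpow_pos_of_pos (by linarith) _
  have hbd : ∃ C, ∀ m : ℕ, S ^ (m + 1) / (m.factorial : ℝ) ≤ C := by
    have h := (FloorSemiring.tendsto_pow_div_factorial_atTop S).bddAbove_range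
    obtain ⟨C, hC⟩ := h
    refine ⟨S * C, fun m => ?_⟩
    have := hC ⟨m, rfl⟩
    simp only at this
    calc S ^ (m + 1) / (m.factorial : ℝ) = S * (S ^ m / (m.factorial : ℝ)) := by ring
      _ ≤ S * C := by gcongr
  obtain ⟨C, hC⟩ := hbd
  have hkey : ∀ᶠ k : ℕ in atTop,
      ‖(Real.Gamma (α * k + 1))⁻¹ * r ^ k‖ ≤ C * (1 / 2 : ℝ) ^ k := by
    have h1 : ∀ᶠ k : ℕ in atTop, (1 : ℝ) ≤ α * k :=
      (tendsto_natCast_atTop_atTop.const_mul_atTop hα0).eventually_ge_atTop 1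
    filter_upwards [h1] with k hk
    have hm1 : 1 ≤ ⌊α * k⌋₊ := Nat.one_le_floor_iff _ |>.2 hk
    have hfl : (⌊α * k⌋₊ : ℝ) ≤ α * k := Nat.floor_le (by linarith)
    have hfl2 : α * k < ⌊α * k⌋₊ + 1 := Nat.lt_floor_add_one _
    set m := ⌊α * k⌋₊ with hm
    have hm1' : (1 : ℝ) ≤ m := by exact_mod_cast hm1
    have hG : (m.factorial : ℝ) ≤ Real.Gamma (α * k + 1) := by
      rw [← Real.Gamma_nat_eq_factorial]
      exact Real.Gamma_strictMonoOn_Ici.monotoneOn (by simp; linarith) (by simp; linarith)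
        (by linarith)
    have hfac : (0 : ℝ) < m.factorial := by exact_mod_cast m.factorial_pos
    have hGpos : 0 < Real.Gamma (α * k + 1) := lt_of_lt_of_le hfac hG
    have hRS : R ^ k ≤ S ^ (m + 1) := by
      rw [← Real.rpow_natCast, ← Real.rpow_natCast S, hS, ← Real.rpow_mul (by linarith)]
      apply Real.rpow_le_rpow_of_exponent_le hR1
      push_cast
      rw [div_mul_eq_mul_div, one_mul, le_div_iff₀ hα0]
      linarith
    rw [Real.norm_of_nonneg (by positivity)]
    calc (Real.Gamma (α * k + 1))⁻¹ * r ^ k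
        ≤ (m.factorial : ℝ)⁻¹ * (R * (1 / 2)) ^ k := by
          gcongr
          rw [hR]; linarith
      _ = ((m.factorial : ℝ)⁻¹ * R ^ k) * (1 / 2) ^ k := by rw [mul_pow]; ring
      _ ≤ ((m.factorial : ℝ)⁻¹ * S ^ (m + 1)) * (1 / 2) ^ k := by gcongr
      _ = (S ^ (m + 1) / (m.factorial : ℝ)) * (1 / 2) ^ k := by ring
      _ ≤ C * (1 / 2) ^ k := by gcongr; exact hC m
  exact Summable.of_norm_bounded_eventually_nat
    ((summable_geometric_of_lt_one (by norm_num) (by norm_num)).mul_left C) hkey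

section
attribute [local instance] Matrix.linftyOpNormedRing Matrix.linftyOpNormedAlgebra

theorem ml_matrix_summable {n : Type*} [Fintype n] [DecidableEq n] [Nonempty n]
    (α : ℝ) (hα0 : 0 < α) (B : Matrix n n ℝ) :
    Summable (fun k : ℕ => (Real.Gamma (α * k + 1))⁻¹ • B ^ k) := by
  refine Summable.of_norm_bounded_eventually_nat (ml_summable α hα0 ‖B‖ (norm_nonneg _)) ?_
  filter_upwards [Filter.eventually_gt_atTop 0] with k hk
  have hG : 0 < Real.Gamma (α * k + 1) := Real.Gamma_pos_of_pos (by positivity)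
  rw [norm_smul, Real.norm_of_nonneg (by positivity)]
  gcongr
  exact norm_pow_le' B hk
end

theorem ml_matrix_hasSum {n : Type*} [Fintype n] [DecidableEq n] [Nonempty n]
    (α : ℝ) (hα0 : 0 < α) (B : Matrix n n ℝ) :
    HasSum (fun k : ℕ => (Real.Gamma (α * k + 1))⁻¹ • B ^ k) (mlMatR α B) :=
  (ml_matrix_summable α hα0 B).hasSum

theorem ml_det_ne_zero {n : Type*} [Fintype n] [DecidableEq n] [Nonempty n]
    (α : ℝ) (hα0 : 0 < α) (B : Matrix n n ℝ)
    (h : ∀ (μ : ℂ) (w : n → ℂ), w ≠ 0 → (B.map Complex.ofReal).mulVec w = μ • w →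
      mlE α μ ≠ 0) : (mlMatR α B).det ≠ 0 := by
  intro hdet
  have hs := ml_matrix_hasSum α hα0 B
  have hcomm : B * mlMatR α B = mlMatR α B * B := by
    refine (hs.mul_left B).unique ?_
    convert hs.mul_right B using 2 with k
    rw [mul_smul_comm, smul_mul_assoc, (Commute.self_pow B k).eq]
  set M := mlMatR α B with hM
  set Mc : Matrix n n ℂ := M.map Complex.ofReal with hMc
  set Bc : Matrix n n ℂ := B.map Complex.ofReal with hBc
  have hcommC : Bc * Mc = Mc * Bc := by
    have := congrArg (fun X : Matrix n n ℝ => X.map Complex.ofRealHom) hcomm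
    simp only [Matrix.map_mul] at this
    exact this
  have hdetC : Mc.det = 0 := by
    have := (RingHom.map_det Complex.ofRealHom M).symm
    rw [hdet, map_zero] at this
    exact this
  have hsC : HasSum (fun k : ℕ => ((Real.Gamma (α * k + 1) : ℂ))⁻¹ • Bc ^ k) Mc := by
    have h2 := hs.map (Complex.ofRealHom.mapMatrix (m := n)).toAddMonoidHom
      (by exact Continuous.matrix_map continuous_id Complex.continuous_ofReal)
    have : (fun k : ℕ => ((Real.Gamma (α * k + 1) : ℂ))⁻¹ • Bc ^ k) =
        (Complex.ofRealHom.mapMatrix (m := n)).toAddMonoidHom ∘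
          (fun k : ℕ => (Real.Gamma (α * k + 1))⁻¹ • B ^ k) := by
      funext k
      have hp : Bc ^ k = Complex.ofRealHom.mapMatrix (B ^ k) := by
        rw [map_pow]; rfl
      rw [hp]
      ext i j
      simp
    rw [this]
    exact h2
  obtain ⟨v, hv0, hv⟩ := Matrix.exists_mulVec_eq_zero_iff.2 hdetC
  -- restrict to the kernel
  let K : Submodule ℂ (n → ℂ) := LinearMap.ker (Matrix.mulVecLin Mc)
  have hinv : ∀ x ∈ K, Matrix.mulVecLin Bc x ∈ K := by
    intro x hx
    simp only [K, LinearMap.mem_ker, Matrix.mulVecLin_apply] at hx ⊢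
    rw [Matrix.mulVec_mulVec, ← hcommC, ← Matrix.mulVec_mulVec, hx, Matrix.mulVec_zero]
  have : Nontrivial K := ⟨⟨⟨v, by simpa [K] using hv⟩, 0, fun e => hv0 (congrArg Subtype.val e)⟩⟩
  obtain ⟨μ, hμ⟩ := Module.End.exists_eigenvalue ((Matrix.mulVecLin Bc).restrict hinv)
  obtain ⟨w, hw⟩ := hμ.exists_hasEigenvector
  have hw1 : Bc.mulVec (w : n → ℂ) = μ • (w : n → ℂ) := by
    have := congrArg Subtype.val hw.apply_eq_smul
    simpa using this
  have hw0 : (w : n → ℂ) ≠ 0 := fun e => hw.2 (Subtype.ext e)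
  have hwK : Mc.mulVec (w : n → ℂ) = 0 := by
    exact LinearMap.mem_ker.1 w.2
  refine h μ w hw0 hw1 ?_
  have hpow : ∀ k : ℕ, (Bc ^ k).mulVec (w : n → ℂ) = μ ^ k • (w : n → ℂ) := by
    intro k
    induction k with
    | zero => simp
    | succ k ih => rw [pow_succ, ← Matrix.mulVec_mulVec, hw1, Matrix.mulVec_smul, ih, smul_smul,
        pow_succ, mul_comm]
  have hsv : HasSum (fun k : ℕ => (((Real.Gamma (α * k + 1) : ℂ))⁻¹ * μ ^ k) • (w : n → ℂ))
      (Mc.mulVec (w : n → ℂ)) := by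
    have h2 := hsC.map (Matrix.mulVec.addMonoidHomLeft (w : n → ℂ))
      (by exact Continuous.matrix_mulVec continuous_id continuous_const)
    convert h2 using 2 with k
    · simp [Matrix.mulVec.addMonoidHomLeft, Matrix.smul_mulVec, hpow, smul_smul]
    · rfl
  rw [hwK] at hsv
  obtain ⟨i, hi⟩ := Function.ne_iff.1 hw0
  have hsi := (Pi.hasSum.1 hsv) i
  simp only [Pi.smul_apply, smul_eq_mul, Pi.zero_apply] at hsi
  have h3 := hsi.mul_right ((w : n → ℂ) i)⁻¹
  have h4 : HasSum (fun k : ℕ => ((Real.Gamma (α * k + 1) : ℂ))⁻¹ * μ ^ k) 0 := by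
    rw [zero_mul] at h3
    have he : (fun k : ℕ => ((Real.Gamma (α * k + 1) : ℂ))⁻¹ * μ ^ k) =
        fun k : ℕ => ((Real.Gamma (α * k + 1) : ℂ))⁻¹ * μ ^ k * (w : n → ℂ) i *
          ((w : n → ℂ) i)⁻¹ := by
      funext k
      exact (mul_inv_cancel_right₀ hi _).symm
    rw [he]
    exact h3
  exact h4.tsum_eq

theorem generalized_separation_theorem {n : Type*} [Fintype n] [DecidableEq n] [Nonempty n]
    (α : ℝ) (hα0 : 0 < α) (hα1 : α < 1) (A : Matrix n n ℝ)
    (harg : ∀ lam ∈ spectrum ℂ (A.map Complex.ofReal),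
      ∀ ζ : ℂ, mlE α ζ = 0 → lam.arg ≠ ζ.arg) :
    ∀ p : n → ℝ, ∀ T : ℝ, 0 < T →
      ∃! xT : n → ℝ, (mlMatR α ((T ^ α) • A)).mulVec xT = p := by
  intro p T hT
  have hc : 0 < T ^ α := Real.rpow_pos_of_pos hT α
  set c := T ^ α with hcdef
  have hdet : (mlMatR α (c • A)).det ≠ 0 := by
    apply ml_det_ne_zero α hα0
    intro μ w hw0 hw hE
    have hcC : (c : ℂ) ≠ 0 := by exact_mod_cast hc.ne'
    have hmap : (c • A).map Complex.ofReal = (c : ℂ) • A.map Complex.ofReal := by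
      ext i j; simp
    rw [hmap, Matrix.smul_mulVec] at hw
    have hw' : (A.map Complex.ofReal).mulVec w = ((c⁻¹ : ℝ) * μ : ℂ) • w := by
      rw [mul_smul, ← hw, smul_smul]
      push_cast
      rw [inv_mul_cancel₀ hcC, one_smul]
    refine harg ((c⁻¹ : ℝ) * μ) ?_ μ hE (Complex.arg_real_mul μ (inv_pos.2 hc))
    rw [← Matrix.spectrum_toLin']
    apply Module.End.HasEigenvalue.mem_spectrum
    apply Module.End.hasEigenvalue_of_hasEigenvector (x := w)
    refine ⟨?_, hw0⟩
    rw [Module.End.mem_eigenspace_iff, Matrix.toLin'_apply, hw']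
  have hu : IsUnit (mlMatR α (c • A)).det := isUnit_iff_ne_zero.2 hdet
  refine ⟨(mlMatR α (c • A))⁻¹.mulVec p, ?_, ?_⟩
  · simp [Matrix.mulVec_mulVec, Matrix.mul_nonsing_inv _ hu]
  · intro y hy
    rw [← hy, Matrix.mulVec_mulVec, Matrix.nonsing_inv_mul _ hu, Matrix.one_mulVec]
end
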